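/- Let Γ^1(z),…,Γ^M(z) be L×L matrix-valued functions belonging to S_L(ℝ⁺), Γ(z) = diag(Γ^1(z),…,Γ^M(z)), and let Γ̃(z) be an N×N matrix-valued function belonging to S_N(ℝ⁺). Then for every z ∈ ℂ∖[0,∞) the matrices I_{ML} + Ψ(Γ̃(z)^T) and I_N + c_N (Ψ̄(Γ(z)))^T are invertible, and the functions Υ(z) = −(1/z)(I_{ML} + Ψ(Γ̃(z)^T))^{−1} and Υ̃(z) = −(1/z)(I_N + c_N (Ψ̄(Γ(z)))^T)^{−1} are holomorphic on ℂ∖[0,∞); moreover Υ(z) is block diagonal with each L×L diagonal block belonging to S_L(ℝ⁺), and Υ̃ belongs to S_N(ℝ⁺). -/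

import Mathlib

open MeasureTheory ProbabilityTheory Matrix Complex Filter
open scoped ComplexOrder

noncomputable section

/-- The closed positive real half-line `[0,∞)` viewed as a subset of `ℂ`. -/
def RPlus : Set ℂ := (fun x : ℝ => (x : ℂ)) '' Set.Ici 0

/-- `δ_z`, the distance from `z` to `[0,∞)`. -/
def deltaZ (z : ℂ) : ℝ := Metric.infDist z RPlus

/-- The vector `d_R(ν) = (1, e^{2πiν}, …, e^{2πi(R−1)ν})ᵀ`. -/
def dvec (R : ℕ) (ν : ℝ) : Fin R → ℂ :=
  fun r => Complex.exp (2 * Real.pi * Complex.I * ν * (r : ℕ))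

/-- The normalized vector `a_R(ν) = d_R(ν)/√R`. -/
def avec (R : ℕ) (ν : ℝ) : Fin R → ℂ :=
  fun r => (Real.sqrt R : ℂ)⁻¹ * dvec R ν r

/-- The operator `Ψ_K^{(m)}` associated with a spectral density `S`:
`Ψ_K(B) = ∫₀¹ S(ν) (a_R(ν)ᴴ B a_R(ν)) d_K(ν) d_K(ν)ᴴ dν`. -/
def PsiOp (S : ℝ → ℝ) {R : ℕ} (K : ℕ) (B : Matrix (Fin R) (Fin R) ℂ) :
    Matrix (Fin K) (Fin K) ℂ :=
  fun i j => ∫ ν in (0:ℝ)..1,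
    (S ν : ℂ) * (star (avec R ν) ⬝ᵥ B.mulVec (avec R ν))
      * (dvec K ν i * (starRingEnd ℂ) (dvec K ν j))

/-- The block-diagonal operator `Ψ` : for an `N×N` matrix `B`, `Ψ(B)` is the `ML×ML`
block-diagonal matrix with `m`-th diagonal block `Ψ_L^{(m)}(B)`. -/
def PsiBlock (L : ℕ) {M N : ℕ} (S : Fin M → ℝ → ℝ) (B : Matrix (Fin N) (Fin N) ℂ) :
    Matrix (Fin M × Fin L) (Fin M × Fin L) ℂ :=
  fun p q => if p.1 = q.1 then PsiOp (S p.1) L B p.2 q.2 else 0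

/-- The `m`-th diagonal `L×L` block of an `ML×ML` matrix. -/
def diagBlock {L M : ℕ} (A : Matrix (Fin M × Fin L) (Fin M × Fin L) ℂ) (m : Fin M) :
    Matrix (Fin L) (Fin L) ℂ :=
  fun i j => A (m, i) (m, j)

/-- The operator `Ψ̄` : `Ψ̄(A) = (1/M) Σ_m Ψ_N^{(m)}(A^{m,m})`. -/
def PsiBar (N : ℕ) {L M : ℕ} (S : Fin M → ℝ → ℝ)
    (A : Matrix (Fin M × Fin L) (Fin M × Fin L) ℂ) : Matrix (Fin N) (Fin N) ℂ :=
  (M : ℂ)⁻¹ • ∑ m : Fin M, PsiOp (S m) N (diagBlock A m)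

/-- `Im X = (X − Xᴴ)/(2i)`. -/
def imMat {n : Type*} [Fintype n] (A : Matrix n n ℂ) : Matrix n n ℂ :=
  (2 * Complex.I)⁻¹ • (A - Aᴴ)

/-- The class `S_K(ℝ⁺)` of `K×K` matrix-valued Stieltjes transforms: holomorphic on
`ℂ∖[0,∞)`, `Im S(z) ≥ 0` and `Im (z S(z)) ≥ 0` for `Im z > 0`, and `−iy S(iy) → I`
as `y → +∞`. -/
def ClassS {K : Type*} [Fintype K] [DecidableEq K] (F : ℂ → Matrix K K ℂ) : Prop :=
  (∀ i j, DifferentiableOn ℂ (fun z => F z i j) RPlusᶜ) ∧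
  (∀ z : ℂ, 0 < z.im → (imMat (F z)).PosSemidef) ∧
  (∀ z : ℂ, 0 < z.im → (imMat (z • F z)).PosSemidef) ∧
  Tendsto (fun y : ℝ => (-(Complex.I * (y : ℂ))) • F (Complex.I * y)) atTop
    (nhds (1 : Matrix K K ℂ))

lemma mem_RPlus_compl {z : ℂ} : z ∈ RPlusᶜ ↔ -z ∈ slitPlane := by
  rw [Complex.mem_slitPlane_iff]
  simp only [RPlus, Set.mem_compl_iff, Set.mem_image, Set.mem_Ici, not_exists, not_and, neg_re,
    neg_im, ne_eq, neg_eq_zero]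
  constructor
  · intro h
    by_contra hc
    push Not at hc
    refine h z.re (by linarith [hc.1]) (Complex.ext (by simp) (by simp [hc.2]))
  · rintro h x hx rfl
    simp at h
    linarith

lemma RPlus_compl_eq : RPlusᶜ = (fun z : ℂ => -z) '' slitPlane := by
  ext z
  rw [mem_RPlus_compl]
  constructor
  · intro h
    exact ⟨-z, h, by simp⟩
  · rintro ⟨w, hw, rfl⟩
    simpa using hw

lemma isOpen_RPlus_compl : IsOpen RPlusᶜ := by
  have : RPlusᶜ = (fun z : ℂ => -z) ⁻¹' slitPlane := by
    ext z; rw [mem_RPlus_compl]; rfl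
  rw [this]
  exact isOpen_slitPlane.preimage continuous_neg

lemma isPreconnected_RPlus_compl : IsPreconnected RPlusᶜ := by
  rw [RPlus_compl_eq]
  refine IsPreconnected.image ?_ _ continuous_neg.continuousOn
  exact (starConvex_one_slitPlane.isPathConnected one_mem_slitPlane).isConnected.isPreconnected

lemma conj_mem_RPlus_compl {z : ℂ} (hz : z ∈ RPlusᶜ) : (starRingEnd ℂ) z ∈ RPlusᶜ := by
  rw [mem_RPlus_compl, Complex.mem_slitPlane_iff] at *
  simpa using hz

lemma mem_of_im_pos {z : ℂ} (hz : z.im ≠ 0) : z ∈ RPlusᶜ := by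
  rw [mem_RPlus_compl, Complex.mem_slitPlane_iff]
  right; simpa using hz

lemma mem_of_re_neg {z : ℂ} (hz : z.re < 0) : z ∈ RPlusᶜ := by
  rw [mem_RPlus_compl, Complex.mem_slitPlane_iff]
  left; simpa using hz

lemma ne_zero_of_mem {z : ℂ} (hz : z ∈ RPlusᶜ) : z ≠ 0 := by
  rintro rfl
  rw [mem_RPlus_compl, Complex.mem_slitPlane_iff] at hz
  simp at hz

section scalar
variable {f : ℂ → ℂ} (hf : DifferentiableOn ℂ f RPlusᶜ)
  (h1 : ∀ z : ℂ, 0 < z.im → 0 ≤ (f z).im) (h2 : ∀ z : ℂ, 0 < z.im → 0 ≤ (z * f z).im)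
include hf h1 h2

lemma scalar_neg (x : ℝ) (hx : x < 0) : 0 ≤ (f x).re ∧ (f x).im = 0 := by
  have hxm : (x : ℂ) ∈ RPlusᶜ := mem_of_re_neg (by simpa using hx)
  have hc : ContinuousAt f x := (hf.differentiableAt (isOpen_RPlus_compl.mem_nhds hxm)).continuousAt
  have ht0 : Tendsto (fun y : ℝ => (x : ℂ) + y * I) (nhdsWithin 0 (Set.Ioi 0)) (nhds (x : ℂ)) := by
    have : Tendsto (fun y : ℝ => (x : ℂ) + y * I) (nhds 0) (nhds ((x : ℂ) + (0 : ℝ) * I)) :=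
      Continuous.tendsto (by fun_prop) 0
    simp only [ofReal_zero, zero_mul, add_zero] at this
    exact this.mono_left nhdsWithin_le_nhds
  have ht := hc.tendsto.comp ht0
  have hre := (Complex.continuous_re.tendsto _).comp ht
  have him := (Complex.continuous_im.tendsto _).comp ht
  have hzf := (Complex.continuous_im.tendsto _).comp (ht0.mul ht)
  have hy : ∀ᶠ y : ℝ in nhdsWithin 0 (Set.Ioi 0), 0 < y := self_mem_nhdsWithin
  have a1 : 0 ≤ (f x).im := ge_of_tendsto him (by
    filter_upwards [hy] with y hy
    exact h1 _ (by simpa using hy))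
  have a2 : 0 ≤ ((x : ℂ) * f x).im := ge_of_tendsto hzf (by
    filter_upwards [hy] with y hy
    exact h2 _ (by simpa using hy))
  have a3 : 0 ≤ (f x).re := ge_of_tendsto hre (by
    filter_upwards [hy] with y hy
    have b1 := h1 ((x : ℂ) + y * I) (by simpa using hy)
    have b2 := h2 ((x : ℂ) + y * I) (by simpa using hy)
    simp only [mul_im, add_re, ofReal_re, mul_re, I_re, mul_zero, ofReal_im, I_im, mul_one,
      sub_self, add_zero, add_im, zero_add] at b2
    simp only [Function.comp]
    by_contra hcon
    push Not at hcon
    nlinarith)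
  refine ⟨a3, le_antisymm ?_ a1⟩
  simp at a2
  nlinarith

lemma scalar_reflect {z : ℂ} (hz : z ∈ RPlusᶜ) :
    f ((starRingEnd ℂ) z) = (starRingEnd ℂ) (f z) := by
  have hg : DifferentiableOn ℂ ((starRingEnd ℂ) ∘ f ∘ (starRingEnd ℂ)) RPlusᶜ := by
    intro w hw
    have := (hf.differentiableAt (isOpen_RPlus_compl.mem_nhds (conj_mem_RPlus_compl hw))).conj_conj
    rw [Complex.conj_conj] at this
    exact this.differentiableWithinAt
  have hm : (-1 : ℂ) ∈ RPlusᶜ := mem_of_re_neg (by simp)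
  have key := (hf.analyticOnNhd isOpen_RPlus_compl).eqOn_of_preconnected_of_frequently_eq
    (hg.analyticOnNhd isOpen_RPlus_compl) isPreconnected_RPlus_compl hm (by
      have htt : Tendsto (fun y : ℝ => (-1 : ℂ) + (-y : ℝ)) (nhdsWithin 0 (Set.Ioi 0))
          (nhdsWithin (-1) {-1}ᶜ) := by
        refine tendsto_nhdsWithin_iff.2 ⟨?_, ?_⟩
        · have : Tendsto (fun y : ℝ => (-1 : ℂ) + (-y : ℝ)) (nhds 0)
              (nhds ((-1 : ℂ) + (-0 : ℝ))) := Continuous.tendsto (by fun_prop) 0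
          simp only [ofReal_neg, ofReal_zero, neg_zero, add_zero] at this
          simpa using this.mono_left nhdsWithin_le_nhds
        · filter_upwards [self_mem_nhdsWithin] with y hy
          have : y ≠ 0 := ne_of_gt hy
          simpa using this
      refine htt.frequently (Eventually.frequently ?_)
      filter_upwards [self_mem_nhdsWithin] with y hy
      have hy' : (0 : ℝ) < y := hy
      have e : (-1 : ℂ) + (-y : ℝ) = ((-1 - y : ℝ) : ℂ) := by push_cast; ring
      rw [e]
      have := (scalar_neg hf h1 h2 (-1 - y) (by linarith)).2
      simp only [Function.comp, Complex.conj_ofReal]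
      exact (Complex.conj_eq_iff_im.2 this).symm)
  have := key (conj_mem_RPlus_compl hz)
  simpa using this

lemma scalar_ne {z : ℂ} (hz : z ∈ RPlusᶜ) (t : ℝ) (ht : 0 < t) : (t : ℂ) + f z ≠ 0 := by
  intro h0
  rcases lt_trichotomy z.im 0 with h | h | h
  · have hr := scalar_reflect hf h1 h2 hz
    have := h2 ((starRingEnd ℂ) z) (by simpa using h)
    rw [hr, eq_neg_of_add_eq_zero_right h0] at this
    simp at this
    nlinarith
  · have hz' : z = (z.re : ℂ) := Complex.ext (by simp) (by simp [h])
    have hre : z.re < 0 := by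
      rw [mem_RPlus_compl, Complex.mem_slitPlane_iff] at hz
      simpa [h] using hz
    have := (scalar_neg hf h1 h2 z.re hre).1
    rw [← hz', eq_neg_of_add_eq_zero_right h0] at this
    simp at this
    linarith
  · have := h2 z h
    rw [eq_neg_of_add_eq_zero_right h0] at this
    simp at this
    nlinarith

end scalar

/-- quadratic form -/
def qf {n : Type*} [Fintype n] (A : Matrix n n ℂ) (x : n → ℂ) : ℂ := star x ⬝ᵥ A.mulVec x

lemma qf_sum {n : Type*} [Fintype n] (A : Matrix n n ℂ) (x : n → ℂ) :
    qf A x = ∑ i, ∑ j, (starRingEnd ℂ) (x i) * A i j * x j := by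
  simp only [qf, dotProduct, mulVec, Finset.mul_sum, Pi.star_apply, mul_assoc]
  rfl

lemma qf_smul {n : Type*} [Fintype n] (c : ℂ) (A : Matrix n n ℂ) (x : n → ℂ) :
    qf (c • A) x = c * qf A x := by
  simp [qf, smul_mulVec]

lemma qf_add {n : Type*} [Fintype n] (A B : Matrix n n ℂ) (x : n → ℂ) :
    qf (A + B) x = qf A x + qf B x := by
  simp [qf, add_mulVec]

lemma qf_conjTranspose {n : Type*} [Fintype n] (A : Matrix n n ℂ) (x : n → ℂ) :
    qf Aᴴ x = (starRingEnd ℂ) (qf A x) := by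
  rw [qf_sum, qf_sum, Finset.sum_comm]
  simp only [map_sum, map_mul, conjTranspose_apply, Complex.conj_conj]
  refine Finset.sum_congr rfl fun i _ => Finset.sum_congr rfl fun j _ => ?_
  simp only [RCLike.star_def]
  ring

lemma qf_transpose {n : Type*} [Fintype n] (A : Matrix n n ℂ) (x : n → ℂ) :
    qf Aᵀ x = qf A (star x) := by
  rw [qf_sum, qf_sum, Finset.sum_comm]
  refine Finset.sum_congr rfl fun i _ => Finset.sum_congr rfl fun j _ => ?_
  simp
  ring

lemma qf_one {n : Type*} [Fintype n] [DecidableEq n] (x : n → ℂ) :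
    qf 1 x = ((∑ i, Complex.normSq (x i) : ℝ) : ℂ) := by
  simp [qf, dotProduct, Complex.normSq_eq_conj_mul_self]

lemma qf_imMat {n : Type*} [Fintype n] (A : Matrix n n ℂ) (x : n → ℂ) :
    qf (imMat A) x = ((qf A x).im : ℂ) := by
  rw [imMat, qf_smul, sub_eq_add_neg, qf_add, ← neg_one_smul ℂ Aᴴ, qf_smul, qf_conjTranspose]
  rw [neg_one_mul, ← sub_eq_add_neg, Complex.sub_conj]
  have := Complex.I_ne_zero
  push_cast
  field_simp

lemma imMat_herm {n : Type*} [Fintype n] (A : Matrix n n ℂ) : (imMat A).IsHermitian := by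
  rw [Matrix.IsHermitian, imMat, conjTranspose_smul, conjTranspose_sub, conjTranspose_conjTranspose,
    ← neg_sub A, smul_neg, ← neg_smul]
  congr 1
  simp

lemma imMat_psd_iff {n : Type*} [Fintype n] (A : Matrix n n ℂ) :
    (imMat A).PosSemidef ↔ ∀ x, 0 ≤ (qf A x).im := by
  rw [posSemidef_iff_dotProduct_mulVec]
  constructor
  · intro h x
    have := h.2 x
    change 0 ≤ qf (imMat A) x at this
    rw [qf_imMat] at this
    exact_mod_cast this
  · intro h
    refine ⟨imMat_herm A, fun x => ?_⟩
    change 0 ≤ qf (imMat A) x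
    rw [qf_imMat]
    exact_mod_cast h x

/-- auxiliary class -/
def ClassT {n : Type*} [Fintype n] (P : ℂ → Matrix n n ℂ) : Prop :=
  (∀ i j, DifferentiableOn ℂ (fun z => P z i j) RPlusᶜ) ∧
  (∀ z : ℂ, 0 < z.im → ∀ x, 0 ≤ (qf (P z) x).im) ∧
  (∀ z : ℂ, 0 < z.im → ∀ x, 0 ≤ (z * qf (P z) x).im) ∧
  (∀ i j, Tendsto (fun y : ℝ => P (Complex.I * y) i j) atTop (nhds 0))

lemma ClassS.toT {n : Type*} [Fintype n] [DecidableEq n] {P : ℂ → Matrix n n ℂ} (h : ClassS P) :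
    ClassT P := by
  obtain ⟨h1, h2, h3, h4⟩ := h
  refine ⟨h1, fun z hz => (imMat_psd_iff _).1 (h2 z hz), fun z hz x => ?_, fun i j => ?_⟩
  · rw [← qf_smul]
    exact (imMat_psd_iff _).1 (h3 z hz) x
  · have h5 : Tendsto (fun y : ℝ => (-(Complex.I * (y : ℂ))) * P (Complex.I * y) i j) atTop
        (nhds ((1 : Matrix n n ℂ) i j)) := tendsto_pi_nhds.1 (tendsto_pi_nhds.1 h4 i) j
    have h6 : Tendsto (fun y : ℝ => (-(Complex.I * (y : ℂ)))⁻¹) atTop (nhds 0) := by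
      have : Tendsto (fun y : ℝ => ((y⁻¹ : ℝ) : ℂ) * I) atTop (nhds (((0 : ℝ) : ℂ) * I)) :=
        ((Complex.continuous_ofReal.tendsto _).comp tendsto_inv_atTop_zero).mul_const I
      simp only [ofReal_zero, zero_mul] at this
      refine this.congr fun y => ?_
      rw [← neg_mul, mul_inv, inv_neg, inv_I]
      push_cast
      ring
    have h7 := h6.mul h5
    rw [zero_mul] at h7
    refine h7.congr' ?_
    filter_upwards [eventually_gt_atTop 0] with y hy
    have : (y : ℂ) ≠ 0 := by exact_mod_cast hy.ne'
    have := Complex.I_ne_zero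
    field_simp

lemma ClassT.diff_qf {n : Type*} [Fintype n] {P : ℂ → Matrix n n ℂ} (h : ClassT P) (x : n → ℂ) :
    DifferentiableOn ℂ (fun z => qf (P z) x) RPlusᶜ := by
  simp only [qf_sum]
  refine DifferentiableOn.fun_sum fun i _ => DifferentiableOn.fun_sum fun j _ => ?_
  exact ((h.1 i j).const_mul _).mul_const _

lemma ClassT.isUnit {n : Type*} [Fintype n] [DecidableEq n] {P : ℂ → Matrix n n ℂ} (h : ClassT P)
    {z : ℂ} (hz : z ∈ RPlusᶜ) : IsUnit (1 + P z) := by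
  rw [Matrix.isUnit_iff_isUnit_det, isUnit_iff_ne_zero]
  intro hd
  obtain ⟨v, hv, h0⟩ := Matrix.exists_mulVec_eq_zero_iff.2 hd
  have hq : qf (1 + P z) v = 0 := by rw [qf, h0, dotProduct_zero]
  rw [qf_add, qf_one] at hq
  refine scalar_ne (h.diff_qf v) (fun z hz => h.2.1 z hz v) (fun z hz => h.2.2.1 z hz v) hz _ ?_ hq
  obtain ⟨i, hi⟩ := Function.ne_iff.1 hv
  exact Finset.sum_pos' (fun i _ => Complex.normSq_nonneg _)
    ⟨i, Finset.mem_univ i, Complex.normSq_pos.2 hi⟩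

lemma diff_det {n : Type*} [Fintype n] [DecidableEq n] {A : ℂ → Matrix n n ℂ} {U : Set ℂ}
    (h : ∀ i j, DifferentiableOn ℂ (fun z => A z i j) U) :
    DifferentiableOn ℂ (fun z => (A z).det) U := by
  simp only [Matrix.det_apply']
  refine DifferentiableOn.fun_sum fun σ _ => DifferentiableOn.const_mul ?_ _
  exact DifferentiableOn.fun_finsetProd fun i _ => h _ _

lemma diff_adj {n : Type*} [Fintype n] [DecidableEq n] {A : ℂ → Matrix n n ℂ} {U : Set ℂ}
    (h : ∀ i j, DifferentiableOn ℂ (fun z => A z i j) U) (i j : n) :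
    DifferentiableOn ℂ (fun z => (A z).adjugate i j) U := by
  simp only [Matrix.adjugate_apply]
  refine diff_det fun k l => ?_
  simp only [Matrix.updateRow_apply]
  split_ifs
  · exact differentiableOn_const _
  · exact h k l

lemma qf_inv {n : Type*} [Fintype n] [DecidableEq n] {A : Matrix n n ℂ} (h : IsUnit A)
    (x : n → ℂ) : qf A⁻¹ x = (starRingEnd ℂ) (qf A (A⁻¹.mulVec x)) := by
  have hd := (Matrix.isUnit_iff_isUnit_det A).1 h
  rw [← qf_conjTranspose, qf, qf, Matrix.star_mulVec, ← Matrix.dotProduct_mulVec,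
    Matrix.mulVec_mulVec, Matrix.mulVec_mulVec, ← Matrix.conjTranspose_mul,
    Matrix.mul_nonsing_inv _ hd]
  simp

lemma ClassT.toS {n : Type*} [Fintype n] [DecidableEq n] {P : ℂ → Matrix n n ℂ} (h : ClassT P) :
    ClassS (fun z => (-z⁻¹) • (1 + P z)⁻¹) := by
  have hA : ∀ i j, DifferentiableOn ℂ (fun z => (1 + P z) i j) RPlusᶜ := fun i j => by
    simp only [Matrix.add_apply]
    exact (differentiableOn_const _).add (h.1 i j)
  refine ⟨fun i j => ?_, fun z hz => ?_, fun z hz => ?_, ?_⟩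
  · simp only [Matrix.smul_apply, Matrix.inv_def, Ring.inverse_eq_inv', smul_eq_mul]
    refine DifferentiableOn.mul ?_ (DifferentiableOn.mul ?_ (diff_adj hA i j))
    · exact (differentiableOn_id.inv fun z hz => ne_zero_of_mem hz).neg
    · refine (diff_det hA).inv fun z hz => ?_
      exact isUnit_iff_ne_zero.1 ((Matrix.isUnit_iff_isUnit_det _).1 (h.isUnit hz))
  · have hzm := mem_of_im_pos hz.ne'
    rw [imMat_psd_iff]
    intro x
    rw [qf_smul, qf_inv (h.isUnit hzm)]
    set u := (1 + P z)⁻¹.mulVec x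
    have a := h.2.2.1 z hz u
    have b : 0 ≤ (z * qf (1 + P z) u).im := by
      rw [qf_add, mul_add, add_im, qf_one]
      have : 0 ≤ ∑ i, Complex.normSq (u i) := Finset.sum_nonneg fun i _ => Complex.normSq_nonneg _
      simp only [mul_im, ofReal_re, ofReal_im] at a ⊢
      nlinarith [mul_nonneg hz.le this]
    have e : -z⁻¹ * (starRingEnd ℂ) (qf (1 + P z) u) =
        -(((Complex.normSq z)⁻¹ : ℝ) : ℂ) * (starRingEnd ℂ) (z * qf (1 + P z) u) := by
      rw [Complex.inv_def, map_mul]; ring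
    rw [e, ← ofReal_neg, Complex.im_ofReal_mul, Complex.conj_im, neg_mul_neg]
    exact mul_nonneg (inv_nonneg.2 (Complex.normSq_nonneg z)) b
  · have hzm := mem_of_im_pos hz.ne'
    have hz0 := ne_zero_of_mem hzm
    rw [imMat_psd_iff]
    intro x
    rw [qf_smul, qf_smul, qf_inv (h.isUnit hzm), ← mul_assoc, mul_neg, mul_inv_cancel₀ hz0,
      qf_add, qf_one]
    simpa using h.2.1 z hz _
  · have h0 : Tendsto (fun y : ℝ => 1 + P (I * y)) atTop (nhds (1 + 0)) :=
      tendsto_const_nhds.add (tendsto_pi_nhds.2 fun i => tendsto_pi_nhds.2 fun j => h.2.2.2 i j)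
    rw [add_zero] at h0
    have h1 : Tendsto (fun y : ℝ => (1 + P (I * y))⁻¹) atTop (nhds 1) := by
      simp only [Matrix.inv_def, Ring.inverse_eq_inv']
      have hd : Tendsto (fun y : ℝ => (1 + P (I * y)).det) atTop (nhds 1) := by
        have := ((Continuous.matrix_det continuous_id).tendsto (1 : Matrix n n ℂ)).comp h0
        simpa using! this
      have ha : Tendsto (fun y : ℝ => (1 + P (I * y)).adjugate) atTop (nhds 1) := by
        have := ((Continuous.matrix_adjugate continuous_id).tendsto (1 : Matrix n n ℂ)).comp h0
        simpa using! this
      have := (hd.inv₀ one_ne_zero).smul ha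
      simpa using this
    refine h1.congr' ?_
    filter_upwards [eventually_gt_atTop 0] with y hy
    have : (I * (y : ℂ)) ≠ 0 := mul_ne_zero I_ne_zero (by exact_mod_cast hy.ne')
    rw [smul_smul, neg_mul_neg, mul_inv_cancel₀ this, one_smul]

lemma continuous_dvec (R : ℕ) (r : Fin R) : Continuous fun ν : ℝ => dvec R ν r := by
  unfold dvec; fun_prop

lemma continuous_avec (R : ℕ) (r : Fin R) : Continuous fun ν : ℝ => avec R ν r := by
  unfold avec
  exact continuous_const.mul (continuous_dvec R r)

lemma psi_integrable {S : ℝ → ℝ} (hS : ContinuousOn S (Set.Icc 0 1)) {g : ℝ → ℂ}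
    (hg : Continuous g) : IntervalIntegrable (fun ν => (S ν : ℂ) * g ν) volume 0 1 := by
  refine ContinuousOn.intervalIntegrable_of_Icc zero_le_one ?_
  exact (Complex.continuous_ofReal.comp_continuousOn hS).mul hg.continuousOn

lemma continuous_qf_avec {R : ℕ} (B : Matrix (Fin R) (Fin R) ℂ) :
    Continuous fun ν : ℝ => qf B (avec R ν) := by
  simp only [qf_sum]
  refine continuous_finsetSum _ fun i _ => continuous_finsetSum _ fun j _ => ?_
  exact ((Complex.continuous_conj.comp (continuous_avec R i)).mul continuous_const).mul
    (continuous_avec R j)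

/-- coefficients -/
def psiCoef (S : ℝ → ℝ) (R K : ℕ) (r s : Fin R) (i j : Fin K) : ℂ :=
  ∫ ν in (0:ℝ)..1, (S ν : ℂ) * ((starRingEnd ℂ) (avec R ν r) * avec R ν s
      * (dvec K ν i * (starRingEnd ℂ) (dvec K ν j)))

lemma psi_eq {S : ℝ → ℝ} (hS : ContinuousOn S (Set.Icc 0 1)) {R K : ℕ}
    (B : Matrix (Fin R) (Fin R) ℂ) (i j : Fin K) :
    PsiOp S K B i j = ∑ r, ∑ s, B r s * psiCoef S R K r s i j := by
  have hc : ∀ r s : Fin R, Continuous fun ν : ℝ => (starRingEnd ℂ) (avec R ν r) * avec R ν s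
      * (dvec K ν i * (starRingEnd ℂ) (dvec K ν j)) := fun r s =>
    ((Complex.continuous_conj.comp (continuous_avec R r)).mul (continuous_avec R s)).mul
      ((continuous_dvec K i).mul (Complex.continuous_conj.comp (continuous_dvec K j)))
  unfold PsiOp psiCoef
  simp only [← intervalIntegral.integral_const_mul]
  have e : ∀ r : Fin R, (∑ s, ∫ ν in (0:ℝ)..1, B r s * ((S ν : ℂ) *
      ((starRingEnd ℂ) (avec R ν r) * avec R ν s * (dvec K ν i * (starRingEnd ℂ) (dvec K ν j))))) =
      ∫ ν in (0:ℝ)..1, ∑ s, B r s * ((S ν : ℂ) *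
      ((starRingEnd ℂ) (avec R ν r) * avec R ν s * (dvec K ν i * (starRingEnd ℂ) (dvec K ν j)))) :=
    fun r => (intervalIntegral.integral_finsetSum fun s _ =>
      (psi_integrable hS (hc r s)).const_mul _).symm
  simp only [e]
  rw [← intervalIntegral.integral_finsetSum]
  · congr 1
    ext ν
    change (S ν : ℂ) * qf B (avec R ν) * _ = _
    rw [qf_sum]
    simp only [Finset.mul_sum, Finset.sum_mul]
    refine Finset.sum_congr rfl fun r _ => Finset.sum_congr rfl fun s _ => ?_
    ring
  · intro r _
    have := IntervalIntegrable.sum (μ := volume) (a := 0) (b := 1) Finset.univ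
      (fun s _ => (psi_integrable hS (hc r s)).const_mul (B r s))
    refine this.congr ?_
    intro ν _
    simp

lemma qf_psi {S : ℝ → ℝ} (hS : ContinuousOn S (Set.Icc 0 1)) {R K : ℕ}
    (B : Matrix (Fin R) (Fin R) ℂ) (x : Fin K → ℂ) :
    qf (PsiOp S K B) x = ∫ ν in (0:ℝ)..1, (S ν : ℂ) * (qf B (avec R ν) *
      ((Complex.normSq (∑ i, (starRingEnd ℂ) (x i) * dvec K ν i) : ℝ) : ℂ)) := by
  have hc : ∀ i j : Fin K, Continuous fun ν : ℝ => qf B (avec R ν) *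
      (((starRingEnd ℂ) (x i) * dvec K ν i) * (starRingEnd ℂ) (((starRingEnd ℂ) (x j) * dvec K ν j)))
      := fun i j => (continuous_qf_avec B).mul ((continuous_const.mul (continuous_dvec K i)).mul
        (Complex.continuous_conj.comp (continuous_const.mul (continuous_dvec K j))))
  have e : ∀ i j : Fin K, (starRingEnd ℂ) (x i) * PsiOp S K B i j * x j =
      ∫ ν in (0:ℝ)..1, (S ν : ℂ) * (qf B (avec R ν) *
      (((starRingEnd ℂ) (x i) * dvec K ν i) *
        (starRingEnd ℂ) (((starRingEnd ℂ) (x j) * dvec K ν j)))) := by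
    intro i j
    unfold PsiOp
    rw [← intervalIntegral.integral_const_mul, ← intervalIntegral.integral_mul_const]
    congr 1
    ext ν
    change _ * ((S ν : ℂ) * qf B (avec R ν) * _) * _ = _
    rw [map_mul, Complex.conj_conj]
    ring
  rw [qf_sum]
  simp only [e]
  have e2 : ∀ i : Fin K, (∑ j, ∫ ν in (0:ℝ)..1, (S ν : ℂ) * (qf B (avec R ν) *
      (((starRingEnd ℂ) (x i) * dvec K ν i) *
        (starRingEnd ℂ) (((starRingEnd ℂ) (x j) * dvec K ν j))))) =
      ∫ ν in (0:ℝ)..1, ∑ j, (S ν : ℂ) * (qf B (avec R ν) *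
      (((starRingEnd ℂ) (x i) * dvec K ν i) *
        (starRingEnd ℂ) (((starRingEnd ℂ) (x j) * dvec K ν j)))) :=
    fun i => (intervalIntegral.integral_finsetSum fun j _ => psi_integrable hS (hc i j)).symm
  simp only [e2]
  rw [← intervalIntegral.integral_finsetSum]
  · congr 1
    ext ν
    rw [← Complex.mul_conj, map_sum, Finset.sum_mul_sum]
    simp only [Finset.mul_sum]
  · intro i _
    have := IntervalIntegrable.sum (μ := volume) (a := 0) (b := 1) Finset.univ
      (fun j _ => psi_integrable hS (hc i j))
    refine this.congr ?_
    intro ν _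
    simp

lemma qf_psi_im {S : ℝ → ℝ} (hS : ContinuousOn S (Set.Icc 0 1))
    (hp : ∀ ν ∈ Set.Icc (0:ℝ) 1, 0 < S ν) {R K : ℕ}
    (B : Matrix (Fin R) (Fin R) ℂ) (c : ℂ) (h : ∀ x, 0 ≤ (c * qf B x).im) (x : Fin K → ℂ) :
    0 ≤ (c * qf (PsiOp S K B) x).im := by
  have hd : Continuous fun ν : ℝ =>
      ((Complex.normSq (∑ i, (starRingEnd ℂ) (x i) * dvec K ν i) : ℝ) : ℂ) := by
    refine Complex.continuous_ofReal.comp (Complex.continuous_normSq.comp ?_)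
    exact continuous_finsetSum _ fun i _ => continuous_const.mul (continuous_dvec K i)
  have hint := (psi_integrable hS ((continuous_qf_avec B).mul hd)).const_mul c
  rw [qf_psi hS, ← intervalIntegral.integral_const_mul]
  have := Complex.imCLM.intervalIntegral_comp_comm hint
  simp only [Complex.imCLM_apply, Pi.mul_apply] at this
  rw [← this]
  refine intervalIntegral.integral_nonneg zero_le_one fun ν hν => ?_
  have e : c * ((S ν : ℂ) * (qf B (avec R ν) *
      ((Complex.normSq (∑ i, (starRingEnd ℂ) (x i) * dvec K ν i) : ℝ) : ℂ))) =
      ((S ν * Complex.normSq (∑ i, (starRingEnd ℂ) (x i) * dvec K ν i) : ℝ) : ℂ) *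
        (c * qf B (avec R ν)) := by
    push_cast; ring
  rw [e, Complex.im_ofReal_mul]
  exact mul_nonneg (mul_nonneg (hp ν hν).le (Complex.normSq_nonneg _)) (h _)

lemma ClassT.psi {S : ℝ → ℝ} (hS : ContinuousOn S (Set.Icc 0 1))
    (hp : ∀ ν ∈ Set.Icc (0:ℝ) 1, 0 < S ν) {R : ℕ} (K : ℕ)
    {P : ℂ → Matrix (Fin R) (Fin R) ℂ} (h : ClassT P) : ClassT (fun z => PsiOp S K (P z)) := by
  refine ⟨fun i j => ?_, fun z hz x => ?_, fun z hz x => ?_, fun i j => ?_⟩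
  · simp only [psi_eq hS]
    exact DifferentiableOn.fun_sum fun r _ => DifferentiableOn.fun_sum fun s _ =>
      (h.1 r s).mul_const _
  · have := qf_psi_im hS hp (K := K) (P z) 1 (by simpa using h.2.1 z hz) x
    simpa using this
  · exact qf_psi_im hS hp (P z) z (h.2.2.1 z hz) x
  · simp only [psi_eq hS]
    have : Tendsto (fun y : ℝ => ∑ r, ∑ s, P (I * y) r s * psiCoef S R K r s i j) atTop
        (nhds (∑ r, ∑ s, 0 * psiCoef S R K r s i j)) :=
      tendsto_finsetSum _ fun r _ => tendsto_finsetSum _ fun s _ => (h.2.2.2 r s).mul_const _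
    simpa using this

lemma ClassT.transpose {n : Type*} [Fintype n] {P : ℂ → Matrix n n ℂ} (h : ClassT P) :
    ClassT (fun z => (P z)ᵀ) := by
  refine ⟨fun i j => h.1 j i, fun z hz x => ?_, fun z hz x => ?_, fun i j => h.2.2.2 j i⟩
  · rw [qf_transpose]; exact h.2.1 z hz _
  · rw [qf_transpose]; exact h.2.2.1 z hz _

lemma ClassT.smul {n : Type*} [Fintype n] {P : ℂ → Matrix n n ℂ} (h : ClassT P) (c : ℝ)
    (hc : 0 ≤ c) : ClassT (fun z => (c : ℂ) • P z) := by
  refine ⟨fun i j => (h.1 i j).const_mul _, fun z hz x => ?_, fun z hz x => ?_, fun i j => ?_⟩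
  · rw [qf_smul, Complex.im_ofReal_mul]; exact mul_nonneg hc (h.2.1 z hz _)
  · rw [qf_smul, mul_left_comm, Complex.im_ofReal_mul]; exact mul_nonneg hc (h.2.2.1 z hz _)
  · simpa using (h.2.2.2 i j).const_mul (c : ℂ)

lemma ClassT.add {n : Type*} [Fintype n] {P Q : ℂ → Matrix n n ℂ} (h : ClassT P) (h' : ClassT Q) :
    ClassT (fun z => P z + Q z) := by
  refine ⟨fun i j => (h.1 i j).add (h'.1 i j), fun z hz x => ?_, fun z hz x => ?_, fun i j => ?_⟩
  · rw [qf_add, add_im]; exact add_nonneg (h.2.1 z hz _) (h'.2.1 z hz _)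
  · rw [qf_add, mul_add, add_im]; exact add_nonneg (h.2.2.1 z hz _) (h'.2.2.1 z hz _)
  · simpa using (h.2.2.2 i j).add (h'.2.2.2 i j)

lemma ClassT.zero {n : Type*} [Fintype n] : ClassT (fun _ => (0 : Matrix n n ℂ)) := by
  refine ⟨fun i j => differentiableOn_const _, fun z hz x => ?_, fun z hz x => ?_, fun i j => ?_⟩
  · simp [qf]
  · simp [qf]
  · simp

lemma ClassT.sum {n ι : Type*} [Fintype n] {P : ι → ℂ → Matrix n n ℂ} (s : Finset ι)
    (h : ∀ i, ClassT (P i)) : ClassT (fun z => ∑ i ∈ s, P i z) := by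
  classical
  induction s using Finset.induction_on with
  | empty => simpa using ClassT.zero
  | insert a s ha ih =>
    simp only [Finset.sum_insert ha]
    exact (h a).add ih

lemma qf_block {L M : ℕ} (A : Fin M → Matrix (Fin L) (Fin L) ℂ) (x : Fin M × Fin L → ℂ) :
    qf (fun p q : Fin M × Fin L => if p.1 = q.1 then A p.1 p.2 q.2 else 0) x =
      ∑ m, qf (A m) (fun i => x (m, i)) := by
  refine (qf_sum _ x).trans ?_
  simp only [qf_sum (A _)]
  rw [Fintype.sum_prod_type]
  refine Finset.sum_congr rfl fun m _ => Finset.sum_congr rfl fun i _ => ?_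
  rw [Fintype.sum_prod_type, Finset.sum_eq_single m]
  · simp
  · intro b _ hb
    simp [hb.symm]
  · simp

lemma ClassT.block {L M : ℕ} {P : Fin M → ℂ → Matrix (Fin L) (Fin L) ℂ} (h : ∀ m, ClassT (P m)) :
    ClassT (fun z (p q : Fin M × Fin L) => if p.1 = q.1 then P p.1 z p.2 q.2 else 0) := by
  refine ⟨fun i j => ?_, fun z hz x => ?_, fun z hz x => ?_, fun i j => ?_⟩
  · dsimp only
    split_ifs
    · exact (h i.1).1 _ _
    · exact differentiableOn_const _
  · rw [qf_block (fun m => P m z), im_sum]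
    exact Finset.sum_nonneg fun m _ => (h m).2.1 z hz _
  · rw [qf_block (fun m => P m z), Finset.mul_sum, im_sum]
    exact Finset.sum_nonneg fun m _ => (h m).2.2.1 z hz _
  · dsimp only
    split_ifs
    · exact (h i.1).2.2.2 _ _
    · exact tendsto_const_nhds

lemma ClassS.diagBlock {L M : ℕ} {F : ℂ → Matrix (Fin M × Fin L) (Fin M × Fin L) ℂ}
    (h : ClassS F) (m : Fin M) : ClassS (fun z => diagBlock (F z) m) := by
  obtain ⟨h1, h2, h3, h4⟩ := h
  refine ⟨fun i j => h1 _ _, fun z hz => ?_, fun z hz => ?_, ?_⟩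
  · exact (h2 z hz).submatrix (fun i : Fin L => (m, i))
  · exact (h3 z hz).submatrix (fun i : Fin L => (m, i))
  · refine tendsto_pi_nhds.2 fun i => tendsto_pi_nhds.2 fun j => ?_
    have := tendsto_pi_nhds.1 (tendsto_pi_nhds.1 h4 (m, i)) (m, j)
    have e : (1 : Matrix (Fin M × Fin L) (Fin M × Fin L) ℂ) (m, i) (m, j) =
        (1 : Matrix (Fin L) (Fin L) ℂ) i j := by
      simp [Matrix.one_apply]
    rw [e] at this
    exact this

lemma block_inv {L M : ℕ} {A : Matrix (Fin M × Fin L) (Fin M × Fin L) ℂ} (hu : IsUnit A)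
    (h : ∀ p q : Fin M × Fin L, p.1 ≠ q.1 → A p q = 0) (p q : Fin M × Fin L) (hpq : p.1 ≠ q.1) :
    A⁻¹ p q = 0 := by
  have := hu.invertible
  rcases lt_or_gt_of_ne hpq with hlt | hlt
  · have : A.BlockTriangular (fun p => OrderDual.toDual p.1) := fun i j hij =>
      h i j (fun e => by simp [e] at hij)
    exact blockTriangular_inv_of_blockTriangular this hlt
  · have : A.BlockTriangular (fun p => p.1) := fun i j hij => h i j (fun e => by simp [e] at hij)
    exact blockTriangular_inv_of_blockTriangular this hlt

/-- If `Γ¹,…,Γ^M ∈ S_L(ℝ⁺)`, `Γ = diag(Γ¹,…,Γ^M)` and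
`Γ̃ ∈ S_N(ℝ⁺)`, then for every `z ∈ ℂ∖[0,∞)` the matrices `I + Ψ(Γ̃(z)ᵀ)` and
`I + c_N Ψ̄(Γ(z))ᵀ` are invertible, the functions
`Υ(z) = −(1/z)(I + Ψ(Γ̃(z)ᵀ))⁻¹` and `Υ̃(z) = −(1/z)(I + c_N Ψ̄(Γ(z))ᵀ)⁻¹` are
holomorphic on `ℂ∖[0,∞)`, `Υ` is block diagonal with each `L×L` diagonal block in
`S_L(ℝ⁺)`, and `Υ̃ ∈ S_N(ℝ⁺)`. -/
theorem statement10 (L M N : ℕ) (hL : 0 < L) (hM : 0 < M) (hN : 0 < N)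
    (S : Fin M → ℝ → ℝ) (hScont : ∀ m, ContinuousOn (S m) (Set.Icc 0 1))
    (hSpos : ∀ m, ∀ ν ∈ Set.Icc (0:ℝ) 1, 0 < S m ν)
    (Γm : Fin M → ℂ → Matrix (Fin L) (Fin L) ℂ) (hΓm : ∀ m, ClassS (Γm m))
    (Γt : ℂ → Matrix (Fin N) (Fin N) ℂ) (hΓt : ClassS Γt) :
    let Γ : ℂ → Matrix (Fin M × Fin L) (Fin M × Fin L) ℂ :=
      fun z p q => if p.1 = q.1 then Γm p.1 z p.2 q.2 else 0
    let Υ : ℂ → Matrix (Fin M × Fin L) (Fin M × Fin L) ℂ :=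
      fun z => (-z⁻¹) • (1 + PsiBlock L S ((Γt z)ᵀ))⁻¹
    let Υt : ℂ → Matrix (Fin N) (Fin N) ℂ :=
      fun z => (-z⁻¹) • (1 + (((M * L : ℕ) : ℂ) / N) • (PsiBar N S (Γ z))ᵀ)⁻¹
    (∀ z ∉ RPlus, IsUnit (1 + PsiBlock L S ((Γt z)ᵀ)) ∧
        IsUnit (1 + (((M * L : ℕ) : ℂ) / N) • (PsiBar N S (Γ z))ᵀ)) ∧
    (∀ i j, DifferentiableOn ℂ (fun z => Υ z i j) RPlusᶜ) ∧
    (∀ i j, DifferentiableOn ℂ (fun z => Υt z i j) RPlusᶜ) ∧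
    (∀ z ∉ RPlus, ∀ p q : Fin M × Fin L, p.1 ≠ q.1 → Υ z p q = 0) ∧
    (∀ m, ClassS (fun z => diagBlock (Υ z) m)) ∧
    ClassS Υt := by
  intro Γ Υ Υt
  have hT1 : ClassT (fun z => PsiBlock L S ((Γt z)ᵀ)) :=
    ClassT.block (P := fun m z => PsiOp (S m) L ((Γt z)ᵀ))
      fun m => hΓt.toT.transpose.psi (hScont m) (hSpos m) L
  have hT2 : ClassT (fun z => (((M * L : ℕ) : ℂ) / N) • (PsiBar N S (Γ z))ᵀ) := by
    have hd : ∀ z m, diagBlock (Γ z) m = Γm m z := by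
      intro z m
      ext i j
      simp [diagBlock, Γ]
    have h0 := ((((ClassT.sum Finset.univ fun m => (hΓm m).toT.psi (hScont m) (hSpos m) N).smul
      ((M : ℝ)⁻¹) (by positivity)).transpose).smul (((M * L : ℕ) : ℝ) / N) (by positivity))
    convert h0 using 2 with z
    simp only [PsiBar, hd]
    push_cast
    rfl
  have hS1 : ClassS Υ := hT1.toS
  have hS2 : ClassS Υt := hT2.toS
  refine ⟨fun z hz => ⟨hT1.isUnit hz, hT2.isUnit hz⟩, hS1.1, hS2.1, fun z hz p q hpq => ?_,
    fun m => hS1.diagBlock m, hS2⟩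
  have := block_inv (hT1.isUnit hz) (fun p q hpq => by
    simp [PsiBlock, hpq, Matrix.one_apply, Prod.ext_iff]) p q hpq
  simp only [Υ, Matrix.smul_apply, this, smul_zero]
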